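/- For a topological space X, every point of X is a tight point if and only if for every topological space Y all of whose neighborhood filters are Fréchet filters, the product space X × Y is countably tight (i.e., every neighborhood filter of X × Y is a countably tight filter). -/

import Mathlib

open Filter Set

universe u

/-- Two filters mesh if all their members intersect, i.e. the filter generated by
pairwise intersections (which is `F ⊓ G` in Mathlib's order) is proper. -/
def Mesh {Z : Type u} (F G : Filter Z) : Prop := Filter.NeBot (F ⊓ G)

/-- Fréchet filters: whenever a set `A` meshes `F` there is a proper countably based
filter refining `F ∨ A` (i.e. `≤ F ⊓ 𝓟 A` in Mathlib's order). -/
def Frechet {Z : Type u} (F : Filter Z) : Prop :=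
  ∀ A : Set Z, Mesh (𝓟 A) F →
    ∃ L : Filter Z, L.NeBot ∧ L.IsCountablyGenerated ∧ L ≤ F ⊓ 𝓟 A

/-- Countably tight filters: whenever a set `A` meshes `F` there is a countable set
meshing with `F ∨ A`. -/
def CountablyTight {Z : Type u} (F : Filter Z) : Prop :=
  ∀ A : Set Z, Mesh (𝓟 A) F → ∃ B : Set Z, B.Countable ∧ Mesh (𝓟 B) (F ⊓ 𝓟 A)

/-- A collection `E` of subsets clusters at `p` if every neighborhood of `p` has
infinite intersection with some member of `E`. -/
def Clusters {X : Type u} [TopologicalSpace X] (E : Set (Set X)) (p : X) : Prop :=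
  ∀ U ∈ nhds p, ∃ e ∈ E, (U ∩ e).Infinite

/-- `p` is a tight point if every collection clustering at `p` has a countable
subcollection clustering at `p`. -/
def TightPoint {X : Type u} [TopologicalSpace X] (p : X) : Prop :=
  ∀ E : Set (Set X), Clusters E p → ∃ E' ⊆ E, E'.Countable ∧ Clusters E' p

/-- A tight point in the closure of a set is in the closure of a countable subset of it. -/
theorem TightPoint.exists_countable_subset {X : Type u} [TopologicalSpace X] {p : X}
    (hp : TightPoint p) {D : Set X} (hD : ∀ U ∈ nhds p, (U ∩ D).Nonempty) :
    ∃ C ⊆ D, C.Countable ∧ ∀ U ∈ nhds p, (U ∩ C).Nonempty := by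
  by_cases h : ∀ U ∈ nhds p, (U ∩ D).Infinite
  · obtain ⟨E, hE, hEc, hcl⟩ := hp {e | e ⊆ D ∧ e.Countable} fun U hU => by
      let f := (h U hU).natEmbedding
      have hf : range (fun n => (f n : X)) ⊆ U ∩ D := range_subset_iff.2 fun n => (f n).2
      refine ⟨range fun n => (f n : X), ⟨hf.trans inter_subset_right, countable_range _⟩, ?_⟩
      rw [inter_eq_self_of_subset_right (hf.trans inter_subset_left)]
      exact infinite_range_of_injective (Subtype.val_injective.comp f.injective)
    refine ⟨⋃₀ E, sUnion_subset fun e he => (hE he).1,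
      hEc.sUnion fun e he => (hE he).2, fun U hU => ?_⟩
    obtain ⟨e, he, hinf⟩ := hcl U hU
    exact hinf.nonempty.mono (inter_subset_inter_right U (subset_sUnion_of_mem he))
  · push Not at h
    obtain ⟨U, hU, hfin⟩ := h
    refine ⟨U ∩ D, inter_subset_right, hfin.countable, fun V hV => ?_⟩
    rw [← inter_assoc]
    exact hD _ (inter_mem hV hU)

/-- If `A` meshes the neighborhood filter of `(x, y)` and `y` is a Fréchet point, then over each
neighborhood of `x` there is a sequence in `A` whose second coordinates converge to `y`. -/
theorem Frechet.exists_seq_of_mesh_prod {X Y : Type u} [TopologicalSpace X] [TopologicalSpace Y]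
    {x : X} {y : Y} (hy : Frechet (nhds y)) {A : Set (X × Y)} (hA : Mesh (𝓟 A) (nhds (x, y)))
    {U : Set X} (hU : U ∈ nhds x) :
    ∃ s : ℕ → X × Y, (∀ n, s n ∈ A) ∧ Tendsto (fun n => (s n).2) atTop (nhds y) ∧
      ∀ n, (s n).1 ∈ U := by
  obtain ⟨L, hL, hLc, hle⟩ := hy {z | ∃ w ∈ U, (w, z) ∈ A} (by
    rw [Mesh, inf_comm, inf_principal_neBot_iff]
    intro V hV
    rw [Mesh, inf_comm, inf_principal_neBot_iff] at hA
    obtain ⟨⟨a, b⟩, ⟨ha, hb⟩, hab⟩ := hA _ (prod_mem_nhds hU hV)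
    exact ⟨b, hb, a, ha, hab⟩)
  obtain ⟨t, ht⟩ := exists_seq_tendsto L
  have hev : ∀ᶠ n in atTop, ∃ w ∈ U, (w, t n) ∈ A :=
    ht (hle (mem_inf_of_right (mem_principal_self _)))
  obtain ⟨N, hN⟩ := eventually_atTop.1 hev
  choose w hwU hwA using fun n => hN (n + N) (Nat.le_add_left N n)
  exact ⟨fun n => (w n, t (n + N)), hwA,
    ((ht.mono_right (hle.trans inf_le_left)).comp (tendsto_add_atTop_nat N)), hwU⟩

theorem TightPoint.countablyTight_prod {X Y : Type u} [TopologicalSpace X] [TopologicalSpace Y]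
    {x : X} {y : Y} (hx : TightPoint x) (hy : Frechet (nhds y)) :
    CountablyTight (nhds (x, y)) := by
  intro A hA
  let S : Set (ℕ → X × Y) :=
    {s | (∀ n, s n ∈ A) ∧ Tendsto (fun n => (s n).2) atTop (nhds y)}
  have : Nonempty (X × Y) := ⟨(x, y)⟩
  suffices h : ∃ T ⊆ S, T.Countable ∧ ∀ U ∈ nhds x, ∃ s ∈ T, ∃ᶠ n in atTop, (s n).1 ∈ U by
    obtain ⟨T, hTS, hTc, hT⟩ := h
    refine ⟨⋃ s ∈ T, range s, hTc.biUnion fun s _ => countable_range s, ?_⟩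
    rw [Mesh, inf_comm, inf_principal_neBot_iff]
    intro W hW
    rw [mem_inf_principal, nhds_prod_eq] at hW
    obtain ⟨U, hU, V, hV, hUV⟩ := mem_prod_iff.1 hW
    obtain ⟨s, hs, hfr⟩ := hT U hU
    obtain ⟨n, hnU, hnV⟩ := (hfr.and_eventually ((hTS hs).2 hV)).exists
    exact ⟨s n, hUV (mk_mem_prod hnU hnV) ((hTS hs).1 n), mem_biUnion hs (mem_range_self n)⟩
  let r : (ℕ → X × Y) → Set X := fun s => range fun n => (s n).1
  by_cases hcl : Clusters (r '' S) x
  · obtain ⟨E, hE, hEc, hEcl⟩ := hx _ hcl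
    obtain ⟨T, hTS, hTc, rfl⟩ : ∃ T ⊆ S, T.Countable ∧ r '' T = E := by
      choose! g hgS hg using fun e (he : e ∈ E) => hE he
      refine ⟨g '' E, image_subset_iff.2 hgS, hEc.image g, ?_⟩
      rw [image_image]
      exact (image_congr hg).trans (image_id' E)
    refine ⟨T, hTS, hTc, fun U hU => ?_⟩
    obtain ⟨_, ⟨s, hs, rfl⟩, hinf⟩ := hEcl U hU
    refine ⟨s, hs, Nat.frequently_atTop_iff_infinite.2 fun hfin => hinf ?_⟩
    refine (hfin.image fun n => (s n).1).subset ?_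
    rintro _ ⟨hU, n, rfl⟩
    exact ⟨n, hU, rfl⟩
  · simp only [Clusters] at hcl
    push Not at hcl
    obtain ⟨U₀, hU₀, hfin⟩ := hcl
    let D : Set X := {d | ∃ s ∈ S, ∃ᶠ n in atTop, (s n).1 = d}
    obtain ⟨C, hCD, hCc, hC⟩ := hx.exists_countable_subset (D := D) fun U hU => by
      obtain ⟨s, hsA, hsy, hsU⟩ := hy.exists_seq_of_mesh_prod hA (inter_mem hU hU₀)
      have hrange : (r s).Finite := by
        refine (hfin _ (mem_image_of_mem r ⟨hsA, hsy⟩)).subset fun z hz => ⟨?_, hz⟩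
        obtain ⟨n, rfl⟩ := hz
        exact (hsU n).2
      have : Finite (r s) := hrange
      obtain ⟨d, hd⟩ := Finite.exists_infinite_fiber (rangeFactorization fun n => (s n).1)
      have hd' : {n | (s n).1 = d}.Infinite := by
        rw [infinite_coe_iff] at hd
        exact hd.mono fun n (hn : rangeFactorization _ n = d) => congrArg Subtype.val hn
      obtain ⟨n, hn⟩ := hd'.nonempty
      have hn : (s n).1 = d := hn
      exact ⟨d, hn ▸ (hsU n).1, s, ⟨hsA, hsy⟩, Nat.frequently_atTop_iff_infinite.2 hd'⟩
    choose! g hgS hg using fun d (hd : d ∈ C) => hCD hd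
    refine ⟨g '' C, image_subset_iff.2 hgS, hCc.image g, fun U hU => ?_⟩
    obtain ⟨d, hdU, hdC⟩ := hC U hU
    exact ⟨g d, mem_image_of_mem g hdC, (hg d hdC).mono fun n hn => hn.symm ▸ hdU⟩

/-- The fan over `ι` with spines `α`: all points but `none` are isolated, and a neighborhood
of `none` contains cofinitely many points of every spine. -/
def Fan (ι α : Type u) : Type u := Option (ι × α)

namespace Fan

variable {ι α : Type u}

/-- The apex of the fan. -/
def apex : Fan ι α := none

/-- The point `a` on the spine `i`. -/
def point (i : ι) (a : α) : Fan ι α := some (i, a)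

instance : TopologicalSpace (Fan ι α) where
  IsOpen V := apex ∈ V → ∀ i, {a | point i a ∉ V}.Finite
  isOpen_univ := by simp
  isOpen_inter V W hV hW h i := by
    refine ((hV h.1 i).union (hW h.2 i)).subset fun a ha => ?_
    exact not_and_or.1 ha
  isOpen_sUnion 𝒱 h𝒱 := by
    rintro ⟨V, hV, hmem⟩ i
    exact (h𝒱 V hV hmem i).subset fun a ha haV => ha ⟨V, hV, haV⟩

theorem mem_nhds_apex {V : Set (Fan ι α)} :
    V ∈ nhds apex ↔ apex ∈ V ∧ ∀ i, {a | point i a ∉ V}.Finite := by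
  refine ⟨fun h => ⟨mem_of_mem_nhds h, fun i => ?_⟩, fun h => IsOpen.mem_nhds (fun _ => h.2) h.1⟩
  obtain ⟨W, hWV, hW, hmem⟩ := mem_nhds_iff.1 h
  exact (hW hmem i).subset fun a ha haW => ha (hWV haW)

theorem frechet_nhds (y : Fan ι α) : Frechet (nhds y) := by
  intro A hA
  rw [Mesh, inf_comm, inf_principal_neBot_iff] at hA
  by_cases hy : y ∈ A
  · exact ⟨pure y, inferInstance, inferInstance,
      le_inf (pure_le_nhds y) (by simpa using hy)⟩
  obtain _ | ⟨i, a⟩ := y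
  · have hi : ∃ i, {a | point i a ∈ A}.Infinite := by
      by_contra! h
      obtain ⟨z, hz, hzA⟩ := hA Aᶜ
        (mem_nhds_apex.2 ⟨hy, fun i => by simpa only [mem_compl_iff, not_not] using h i⟩)
      exact hz hzA
    obtain ⟨i, hi⟩ := hi
    let f := hi.natEmbedding
    refine ⟨map (fun n => point i (f n : α)) atTop, inferInstance, inferInstance,
      le_inf (fun V hV => ?_) ?_⟩
    · rw [mem_map, ← Nat.cofinite_eq_atTop]
      exact ((mem_nhds_apex.1 hV).2 i).preimage
        (Subtype.val_injective.comp f.injective).injOn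
    · exact tendsto_principal.2 (Eventually.of_forall fun n => (f n).2)
  · have hopen : IsOpen {(point i a : Fan ι α)} := fun h => by cases h
    obtain ⟨z, hz, hzA⟩ := hA _ (hopen.mem_nhds rfl)
    rw [mem_singleton_iff.1 hz] at hzA
    exact absurd hzA hy

end Fan

/-- Countable tightness of the product of `X` with the fan over `Set X` with spines `X`
detects tight points. -/
theorem TightPoint.of_countablyTight_fan {X : Type u} [TopologicalSpace X] {p : X}
    (h : CountablyTight (nhds (p, (Fan.apex : Fan (Set X) X)))) : TightPoint p := by
  intro E hE
  let A : Set (X × Fan (Set X) X) := {q | ∃ e ∈ E, q.1 ∈ e ∧ q.2 = Fan.point e q.1}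
  obtain ⟨B, hBc, hB⟩ := h A (by
    rw [Mesh, inf_comm, inf_principal_neBot_iff]
    intro W hW
    rw [nhds_prod_eq] at hW
    obtain ⟨U, hU, V, hV, hUV⟩ := mem_prod_iff.1 hW
    obtain ⟨e, he, hinf⟩ := hE U hU
    obtain ⟨a, ⟨haU, hae⟩, haV⟩ := (hinf.sdiff ((Fan.mem_nhds_apex.1 hV).2 e)).nonempty
    exact ⟨(a, Fan.point e a), hUV ⟨haU, not_not.1 haV⟩, e, he, hae, rfl⟩)
  rw [Mesh, inf_comm, inf_principal_neBot_iff] at hB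
  let g : X × Fan (Set X) X → Set X := fun q => q.2.elim ∅ Prod.fst
  refine ⟨g '' B ∩ E, inter_subset_right, (hBc.image g).mono inter_subset_left, fun U hU => ?_⟩
  by_contra! hfin
  let V : Set (Fan (Set X) X) := {z | ¬ ∃ e ∈ g '' B ∩ E, ∃ a ∈ U ∩ e, z = Fan.point e a}
  have hV : V ∈ nhds Fan.apex := by
    refine Fan.mem_nhds_apex.2 ⟨?_, fun e => ?_⟩
    · rintro ⟨e, -, a, -, h⟩
      cases h
    · by_cases he : e ∈ g '' B ∩ E
      · refine (hfin e he).subset fun a ha => ?_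
        obtain ⟨e', -, a', ha', heq⟩ := not_not.1 ha
        cases heq
        exact ha'
      · refine finite_empty.subset fun a ha => ?_
        obtain ⟨e', he', a', -, heq⟩ := not_not.1 ha
        cases heq
        exact he he'
  obtain ⟨⟨a, z⟩, ⟨⟨haU, haV⟩, e, he, hae, hz⟩, hqB⟩ :=
    hB _ (inter_mem_inf (prod_mem_nhds hU hV) (mem_principal_self A))
  dsimp only at hae hz haU haV
  subst hz
  exact haV ⟨e, ⟨⟨_, hqB, rfl⟩, he⟩, a, ⟨haU, hae⟩, rfl⟩

theorem stmt15 {X : Type u} [TopologicalSpace X] :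
    (∀ p : X, TightPoint p) ↔
      ∀ (Y : Type u) [TopologicalSpace Y], (∀ y : Y, Frechet (nhds y)) →
        ∀ q : X × Y, CountablyTight (nhds q) :=
  ⟨fun hX _ _ hY q => (hX q.1).countablyTight_prod (hY q.2),
    fun h p => .of_countablyTight_fan (h (Fan (Set X) X) Fan.frechet_nhds (p, Fan.apex))⟩
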